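/- arXiv:2405.19863 — 6 statements merged into one kernel-verified Lean document; each statement's English description precedes it below -/
import Mathlib

section
/- Let (A,B) be a Katsura pair, i a vertex of E_A and k ∈ ℤ. Then a^k · μ = μ for every finite path μ in E_A with r(μ) = i if and only if A_μ divides k·B_μ for every finite path μ in E_A with r(μ) = i. -/
open scoped Classical

/-- A Katsura pair on a vertex set `V`: matrices `A` (natural entries) and `B` (integer
entries) with `A i j = 0 → B i j = 0`. -/
structure KatsuraPair (V : Type) where
  A : V → V → ℕ
  B : V → V → ℤ
  zero : ∀ i j, A i j = 0 → B i j = 0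

namespace KatsuraPair

variable {V : Type}

/-- An edge `e_{i,j,m}` (with `0 ≤ m < A i j`) of the graph `E_A`; the range is `i` and the
source is `j`. -/
structure Edge (P : KatsuraPair V) where
  i : V
  j : V
  m : ℕ
  hm : m < P.A i j

variable {P : KatsuraPair V}

/-- A finite path `μ = μ₁⋯μₙ`: consecutive edges satisfy `s(μₜ) = r(μₜ₊₁)`. -/
def IsPath (μ : List (Edge P)) : Prop := μ.Chain' (fun e f => e.j = f.i)

/-- `r(μ) = v` (vacuously true for the empty path, viewed as a vertex). -/
def rangeIs (μ : List (Edge P)) (v : V) : Prop := ∀ e ∈ μ.head?, e.i = v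

/-- The source of a path whose range is `v` (so `s` of the empty path at `v` is `v`). -/
def src (v : V) (μ : List (Edge P)) : V := (μ.getLast?).elim v (fun e => e.j)

/-- `A_μ`, the product of the `A`-entries along `μ` (empty product is 1). -/
def Aprod (μ : List (Edge P)) : ℕ := (μ.map (fun e => P.A e.i e.j)).prod

/-- `B_μ`, the product of the `B`-entries along `μ` (empty product is 1). -/
def Bprod (μ : List (Edge P)) : ℤ := (μ.map (fun e => P.B e.i e.j)).prod

/-- `a^k · e_{i,j,m} = e_{i,j,m̂}` where `k·B i j + m = k̂·(A i j) + m̂`, `0 ≤ m̂ < A i j`. -/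
def edgeAct (k : ℤ) (e : Edge P) : Edge P where
  i := e.i
  j := e.j
  m := ((k * P.B e.i e.j + (e.m : ℤ)) % (P.A e.i e.j : ℤ)).toNat
  hm := by
    have hA : 0 < P.A e.i e.j := Nat.lt_of_le_of_lt (Nat.zero_le _) e.hm
    have hA' : (0 : ℤ) < (P.A e.i e.j : ℤ) := by exact_mod_cast hA
    have h1 : 0 ≤ (k * P.B e.i e.j + (e.m : ℤ)) % (P.A e.i e.j : ℤ) :=
      Int.emod_nonneg _ hA'.ne'
    have h2 : (k * P.B e.i e.j + (e.m : ℤ)) % (P.A e.i e.j : ℤ) < (P.A e.i e.j : ℤ) :=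
      Int.emod_lt_of_pos _ hA'
    omega

/-- `a^k|_{e_{i,j,m}} = a^{k̂}` where `k·B i j + m = k̂·(A i j) + m̂`, `0 ≤ m̂ < A i j`. -/
def edgeRes (k : ℤ) (e : Edge P) : ℤ := (k * P.B e.i e.j + (e.m : ℤ)) / (P.A e.i e.j : ℤ)

/-- The action of `a^k` on finite paths: `a^k · (eν) = (a^k · e)(a^k|_e · ν)`. -/
def act : ℤ → List (Edge P) → List (Edge P)
  | _, [] => []
  | k, e :: ν => edgeAct k e :: act (edgeRes k e) ν

/-- The restriction along a path: `a^k|_{eν} = (a^k|_e)|_ν`; `res k μ` is the integer with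
`a^k|_μ = a^{res k μ}`. -/
def res : ℤ → List (Edge P) → ℤ
  | k, [] => k
  | k, e :: ν => res (edgeRes k e) ν

/-- `a^k` and `a^l` act equally at the vertex `v`. -/
def ActEq (P : KatsuraPair V) (k l : ℤ) (v : V) : Prop :=
  ∀ μ : List (Edge P), IsPath μ → rangeIs μ v → act k μ = act l μ

/-- The KEP-action `(G_B, E_A)` is contracting. -/
def Contracting (P : KatsuraPair V) : Prop :=
  ∃ F : Finset ℤ, ∀ k : ℤ, ∀ v : V, ∃ n : ℕ, ∀ μ : List (Edge P),
    IsPath μ → rangeIs μ v → n ≤ μ.length →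
    ∃ l ∈ F, ActEq P (res k μ) l (src v μ)

/-- The KEP-action `(G_B, E_A)` is regular. -/
def Regular (P : KatsuraPair V) : Prop :=
  ∀ k : ℤ, ∀ v : V, ∃ K : ℕ, ∀ μ : List (Edge P),
    IsPath μ → rangeIs μ v → K ≤ μ.length → act k μ = μ →
    ActEq P (res k μ) 0 (src v μ)

/-- `v ∈ E⁰_{A,<∞}`: the quantity `A_μ / gcd(A_μ, |B_μ|)` is bounded over paths `μ` with
range `v` and `B_μ ≠ 0`. -/
def FiniteVertex (P : KatsuraPair V) (v : V) : Prop :=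
  ∃ C : ℕ, ∀ μ : List (Edge P), IsPath μ → rangeIs μ v → Bprod μ ≠ 0 →
    Aprod μ / Nat.gcd (Aprod μ) (Bprod μ).natAbs ≤ C

/-- An edge of `E_{A,∞}`: `B` nonzero and source in `E⁰_{A,∞}`. -/
def InfEdge (e : Edge P) : Prop := P.B e.i e.j ≠ 0 ∧ ¬ FiniteVertex P e.j

/-- An edge of `E_{A,<∞}`: `B` nonzero and range in `E⁰_{A,<∞}`. -/
def FinEdge (e : Edge P) : Prop := P.B e.i e.j ≠ 0 ∧ FiniteVertex P e.i

/-- The infinite part `(A_∞, B_∞)` of a Katsura pair. -/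
def infinitePart (P : KatsuraPair V) : KatsuraPair {v : V // ¬ FiniteVertex P v} where
  A := fun i j => if P.B i.1 j.1 = 0 then 0 else P.A i.1 j.1
  B := fun i j => P.B i.1 j.1
  zero := fun i j h => by
    by_cases hb : P.B i.1 j.1 = 0
    · exact hb
    · simp only [if_neg hb] at h
      exact P.zero _ _ h

/-- The finite part `(A_{<∞}, B_{<∞})` of a Katsura pair. -/
def finitePart (P : KatsuraPair V) : KatsuraPair {v : V // FiniteVertex P v} where
  A := fun i j => if P.B i.1 j.1 = 0 then 0 else P.A i.1 j.1
  B := fun i j => P.B i.1 j.1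
  zero := fun i j h => by
    by_cases hb : P.B i.1 j.1 = 0
    · exact hb
    · simp only [if_neg hb] at h
      exact P.zero _ _ h

end KatsuraPair

namespace KatsuraPair

variable {V : Type} {P : KatsuraPair V}

theorem Edge.A_pos (e : Edge P) : (0 : ℤ) < P.A e.i e.j := by
  exact_mod_cast Nat.lt_of_le_of_lt (Nat.zero_le _) e.hm

theorem edgeAct_eq_self_iff (k : ℤ) (e : Edge P) :
    edgeAct k e = e ↔ (P.A e.i e.j : ℤ) ∣ k * P.B e.i e.j := by
  have hA := e.A_pos
  have hlt : (e.m : ℤ) < P.A e.i e.j := by exact_mod_cast e.hm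
  have hmod : (e.m : ℤ) % P.A e.i e.j = e.m := Int.emod_eq_of_lt (by positivity) hlt
  have hnonneg := Int.emod_nonneg (k * P.B e.i e.j + (e.m : ℤ)) hA.ne'
  have hiff : (k * P.B e.i e.j + (e.m : ℤ)) % P.A e.i e.j = e.m ↔
      (P.A e.i e.j : ℤ) ∣ k * P.B e.i e.j := by
    conv_lhs => rhs; rw [← hmod]
    rw [Int.emod_eq_emod_iff_emod_sub_eq_zero, add_sub_cancel_right, Int.dvd_iff_emod_eq_zero]
  rw [← hiff]
  constructor
  · intro h
    have hm := congrArg Edge.m h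
    simp only [edgeAct] at hm
    omega
  · intro h
    cases e
    simp only [edgeAct, Edge.mk.injEq, true_and] at h ⊢
    omega

theorem mul_edgeRes_of_dvd {k : ℤ} {e : Edge P}
    (h : (P.A e.i e.j : ℤ) ∣ k * P.B e.i e.j) :
    (P.A e.i e.j : ℤ) * edgeRes k e = k * P.B e.i e.j := by
  have hlt : (e.m : ℤ) < P.A e.i e.j := by exact_mod_cast e.hm
  rw [edgeRes, Int.add_ediv_of_dvd_left h, Int.ediv_eq_zero_of_lt (by positivity) hlt, add_zero,
    Int.mul_ediv_cancel' h]

theorem Aprod_dvd_cons_iff {k : ℤ} {e : Edge P} (ν : List (Edge P))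
    (h : (P.A e.i e.j : ℤ) ∣ k * P.B e.i e.j) :
    (Aprod (e :: ν) : ℤ) ∣ k * Bprod (e :: ν) ↔ (Aprod ν : ℤ) ∣ edgeRes k e * Bprod ν := by
  have hB : k * Bprod (e :: ν) = P.A e.i e.j * (edgeRes k e * Bprod ν) := by
    rw [← mul_assoc, mul_edgeRes_of_dvd h]
    simp [Bprod, mul_assoc]
  have hA : (Aprod (e :: ν) : ℤ) = P.A e.i e.j * Aprod ν := by simp [Aprod]
  rw [hA, hB, mul_dvd_mul_iff_left e.A_pos.ne']

theorem Aprod_dvd_of_act_eq_self (μ : List (Edge P)) (k : ℤ) (h : act k μ = μ) :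
    (Aprod μ : ℤ) ∣ k * Bprod μ := by
  induction μ generalizing k with
  | nil => simp [Aprod]
  | cons e ν ih =>
    obtain ⟨he, hν⟩ := List.cons.inj h
    exact (Aprod_dvd_cons_iff ν ((edgeAct_eq_self_iff k e).1 he)).2 (ih _ hν)

theorem act_eq_self_of_forall_dvd (μ : List (Edge P)) (k : ℤ) (v : V)
    (h : ∀ ν : List (Edge P), IsPath ν → rangeIs ν v → (Aprod ν : ℤ) ∣ k * Bprod ν)
    (hμ : IsPath μ) (hv : rangeIs μ v) : act k μ = μ := by
  induction μ generalizing k v with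
  | nil => rfl
  | cons e ν ih =>
    have hev : e.i = v := hv e rfl
    have he : (P.A e.i e.j : ℤ) ∣ k * P.B e.i e.j := by
      simpa [Aprod, Bprod] using
        h [e] (List.isChain_singleton e) (by simpa [rangeIs] using hev)
    obtain ⟨hjν, hν⟩ := List.isChain_cons.1 hμ
    rw [act, (edgeAct_eq_self_iff k e).2 he]
    congr 1
    refine ih _ e.j (fun ξ hξ hξj => (Aprod_dvd_cons_iff ξ he).1 (h (e :: ξ) ?_ ?_)) hν
      fun f hf => (hjν f hf).symm
    · exact List.isChain_cons.2 ⟨fun f hf => (hξj f hf).symm, hξ⟩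
    · simpa [rangeIs] using hev

end KatsuraPair

open KatsuraPair in
/-- for a Katsura pair `(A,B)`, a vertex `i` and `k ∈ ℤ`, `a^k` fixes every
finite path with range `i` iff `A_μ ∣ k·B_μ` for every finite path `μ` with range `i`. -/
theorem statement0 (N : ℕ) (hN : 0 < N) (P : KatsuraPair (Fin N)) (i : Fin N) (k : ℤ) :
    (∀ μ : List (Edge P), IsPath μ → rangeIs μ i → act k μ = μ) ↔
    (∀ μ : List (Edge P), IsPath μ → rangeIs μ i →
      (Aprod μ : ℤ) ∣ k * Bprod μ) := by
  exact ⟨fun h μ hμ hv => Aprod_dvd_of_act_eq_self μ k (h μ hμ hv),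
    fun h μ hμ hv => act_eq_self_of_forall_dvd μ k i h hμ hv⟩
end

section
/- Let (A,B) be a Katsura pair and let E⁰_{A,<∞} = {i ∈ {1,…,N} : sup{A_μ/gcd(A_μ,|B_μ|) : μ a finite path in E_A with r(μ) = i and B_μ ≠ 0} < ∞}. If e = e_{i,j,m} is an edge of E_A with B_{ij} ≠ 0 and i ∈ E⁰_{A,<∞}, then j ∈ E⁰_{A,<∞}. -/
open scoped Classical

/-- Dividing the fraction `b * B / (a * A)` by `b / a` enlarges the reduced denominator by a
factor of at most `b`. -/
theorem Nat.div_gcd_le_mul_of_mul_div_gcd_le {a b A B C : ℕ} (ha : 0 < a) (hb : 0 < b)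
    (hB : 0 < B) (h : a * A / Nat.gcd (a * A) (b * B) ≤ C) :
    A / Nat.gcd A B ≤ b * C := by
  have hdvd : Nat.gcd (a * A) (b * B) ∣ a * b * Nat.gcd A B := by
    rw [← Nat.gcd_mul_left]
    refine Nat.dvd_gcd ((Nat.gcd_dvd_left _ _).trans ⟨b, by ring⟩)
      ((Nat.gcd_dvd_right _ _).trans ⟨a, by ring⟩)
  have hg : 0 < Nat.gcd A B := Nat.gcd_pos_of_pos_right _ hB
  have hle : Nat.gcd (a * A) (b * B) ≤ a * b * Nat.gcd A B :=
    Nat.le_of_dvd (by positivity) hdvd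
  have hA : a * A ≤ a * (b * C * Nat.gcd A B) := calc
    a * A = a * A / Nat.gcd (a * A) (b * B) * Nat.gcd (a * A) (b * B) :=
      (Nat.div_mul_cancel (Nat.gcd_dvd_left _ _)).symm
    _ ≤ C * (a * b * Nat.gcd A B) := Nat.mul_le_mul h hle
    _ = a * (b * C * Nat.gcd A B) := by ring
  exact Nat.div_le_of_le_mul ((Nat.le_of_mul_le_mul_left hA ha).trans_eq (mul_comm _ _))

open KatsuraPair in
/-- if `e = e_{i,j,m}` is an edge of `E_A` with `B i j ≠ 0` and
`i ∈ E⁰_{A,<∞}`, then `j ∈ E⁰_{A,<∞}`. -/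
theorem statement1 (N : ℕ) (hN : 0 < N) (P : KatsuraPair (Fin N)) (e : Edge P)
    (hB : P.B e.i e.j ≠ 0) (hi : FiniteVertex P e.i) :
    FiniteVertex P e.j := by
  obtain ⟨C, hC⟩ := hi
  refine ⟨(P.B e.i e.j).natAbs * C, fun μ hμ hr hBμ => ?_⟩
  have hpath : IsPath (e :: μ) :=
    List.isChain_cons.mpr ⟨fun f hf => (hr f hf).symm, hμ⟩
  have hrange : rangeIs (e :: μ) e.i := by simp [rangeIs]
  have hAe : Aprod (e :: μ) = P.A e.i e.j * Aprod μ := by simp [Aprod]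
  have hBe : Bprod (e :: μ) = P.B e.i e.j * Bprod μ := by simp [Bprod]
  have h := hC (e :: μ) hpath hrange (hBe ▸ mul_ne_zero hB hBμ)
  rw [hAe, hBe, Int.natAbs_mul] at h
  exact Nat.div_gcd_le_mul_of_mul_div_gcd_le (Nat.zero_lt_of_lt e.hm)
    (Int.natAbs_pos.mpr hB) (Int.natAbs_pos.mpr hBμ) h
end

section
/- Let (A,B) be a Katsura pair such that A has no zero rows. Then limsup_{n→∞} ( limsup_{m→∞} max_{μ ∈ E_A^n} |res(m,μ)|/m )^{1/n} = limsup_{n→∞} ( max_{μ ∈ E_A^n} |B_μ|/A_μ )^{1/n}, where E_A^n denotes the set of paths of length n in E_A. (This computes the contraction coefficient of the action-restriction pair (ℤ × E_A⁰, E_A).) -/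
open scoped Classical

namespace KatsuraPair

variable {V : Type}

/-- `max_{μ ∈ E_A^n} |B_μ|/A_μ` (the max over the empty set being 0). -/
noncomputable def maxRatio (P : KatsuraPair V) (n : ℕ) : ℝ :=
  sSup (insert 0 {x : ℝ | ∃ μ : List (Edge P), IsPath μ ∧ μ.length = n ∧
    x = ((Bprod μ).natAbs : ℝ) / (Aprod μ : ℝ)})

/-- `max_{μ ∈ E_A^n} |res(m,μ)|/m` (the max over the empty set being 0). -/
noncomputable def maxResRatio (P : KatsuraPair V) (n m : ℕ) : ℝ :=
  sSup (insert 0 {x : ℝ | ∃ μ : List (Edge P), IsPath μ ∧ μ.length = n ∧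
    x = (((res (m : ℤ) μ).natAbs : ℝ) / (m : ℝ))})

end KatsuraPair

namespace KatsuraPair

variable {V : Type} {P : KatsuraPair V}

/-- The signed ratio `B_μ / A_μ` of a path. -/
noncomputable def ratio (μ : List (Edge P)) : ℝ := (Bprod μ : ℝ) / (Aprod μ : ℝ)

theorem ratio_nil : ratio ([] : List (Edge P)) = 1 := by
  simp [ratio, Bprod, Aprod]

theorem ratio_cons (e : Edge P) (ν : List (Edge P)) :
    ratio (e :: ν) = (P.B e.i e.j : ℝ) / (P.A e.i e.j : ℝ) * ratio ν := by
  simp [ratio, Bprod, Aprod, mul_div_mul_comm]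

theorem abs_ratio (μ : List (Edge P)) :
    |ratio μ| = ((Bprod μ).natAbs : ℝ) / (Aprod μ : ℝ) := by
  rw [ratio, abs_div, Nat.abs_cast, Nat.cast_natAbs, Int.cast_abs]

theorem exists_edge_ratio_le [Finite V] (P : KatsuraPair V) :
    ∃ M : ℝ, 0 ≤ M ∧ ∀ i j, |(P.B i j : ℝ) / (P.A i j : ℝ)| ≤ M := by
  obtain ⟨M, hM⟩ := (Set.finite_range
    fun p : V × V => |(P.B p.1 p.2 : ℝ) / (P.A p.1 p.2 : ℝ)|).bddAbove
  exact ⟨max M 0, le_max_right _ _, fun i j => (hM ⟨(i, j), rfl⟩).trans (le_max_left _ _)⟩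

theorem abs_ratio_le {M : ℝ} (hM₀ : 0 ≤ M)
    (hM : ∀ i j, |(P.B i j : ℝ) / (P.A i j : ℝ)| ≤ M) (μ : List (Edge P)) :
    |ratio μ| ≤ M ^ μ.length := by
  induction μ with
  | nil => simp [ratio_nil]
  | cons e ν ih =>
    rw [ratio_cons, abs_mul, List.length_cons, pow_succ']
    exact mul_le_mul (hM _ _) ih (abs_nonneg _) hM₀

theorem abs_edgeRes_sub_le (k : ℤ) (e : Edge P) :
    |(edgeRes k e : ℝ) - k * ((P.B e.i e.j : ℝ) / (P.A e.i e.j : ℝ))| ≤ 1 := by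
  have hA : 0 < P.A e.i e.j := Nat.zero_lt_of_lt e.hm
  have hA' : (0 : ℝ) < P.A e.i e.j := by exact_mod_cast hA
  have hAz : (0 : ℤ) < P.A e.i e.j := by exact_mod_cast hA
  have hm : (e.m : ℝ) < P.A e.i e.j := by exact_mod_cast e.hm
  have hdiv : (P.A e.i e.j : ℝ) * edgeRes k e +
      (((k * P.B e.i e.j + (e.m : ℤ)) % (P.A e.i e.j : ℤ) : ℤ) : ℝ) =
      k * P.B e.i e.j + e.m := by
    exact_mod_cast Int.mul_ediv_add_emod (k * P.B e.i e.j + (e.m : ℤ)) (P.A e.i e.j : ℤ)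
  have hmod_nonneg : (0 : ℝ) ≤ (((k * P.B e.i e.j + (e.m : ℤ)) % (P.A e.i e.j : ℤ) : ℤ) : ℝ) := by
    exact_mod_cast Int.emod_nonneg _ hAz.ne'
  have hmod_lt : (((k * P.B e.i e.j + (e.m : ℤ)) % (P.A e.i e.j : ℤ) : ℤ) : ℝ) <
      P.A e.i e.j := by
    exact_mod_cast Int.emod_lt_of_pos _ hAz
  have hm₀ : (0 : ℝ) ≤ e.m := Nat.cast_nonneg _
  have hsub : (edgeRes k e : ℝ) - k * ((P.B e.i e.j : ℝ) / (P.A e.i e.j : ℝ)) =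
      (P.A e.i e.j * edgeRes k e - k * P.B e.i e.j) / P.A e.i e.j := by
    field_simp
  rw [hsub, abs_div, abs_of_pos hA', div_le_one hA', abs_le]
  constructor <;> linarith

/-- Restriction along a path is multiplication by `B_μ / A_μ` up to a bounded error. -/
theorem abs_res_sub_le {M : ℝ} (hM₀ : 0 ≤ M)
    (hM : ∀ i j, |(P.B i j : ℝ) / (P.A i j : ℝ)| ≤ M) (μ : List (Edge P)) (k : ℤ) :
    |(res k μ : ℝ) - k * ratio μ| ≤ ∑ t ∈ Finset.range μ.length, M ^ t := by
  induction μ generalizing k with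
  | nil => simp [res, ratio_nil]
  | cons e ν ih =>
    rw [List.length_cons, Finset.sum_range_succ, res, ratio_cons]
    calc |(res (edgeRes k e) ν : ℝ) -
            k * ((P.B e.i e.j : ℝ) / (P.A e.i e.j : ℝ) * ratio ν)|
        = |((res (edgeRes k e) ν : ℝ) - edgeRes k e * ratio ν) +
            (edgeRes k e - k * ((P.B e.i e.j : ℝ) / (P.A e.i e.j : ℝ))) * ratio ν| := by
          congr 1; ring
      _ ≤ _ := (abs_add_le _ _).trans (add_le_add (ih _) ?_)
    rw [abs_mul]
    simpa using mul_le_mul (abs_edgeRes_sub_le k e) (abs_ratio_le hM₀ hM ν) (abs_nonneg _)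
      zero_le_one

theorem abs_natAbs_res_div_sub_le {M : ℝ} (hM₀ : 0 ≤ M)
    (hM : ∀ i j, |(P.B i j : ℝ) / (P.A i j : ℝ)| ≤ M) (μ : List (Edge P)) {m : ℕ}
    (hm : 0 < m) :
    |((res (m : ℤ) μ).natAbs : ℝ) / (m : ℝ) - ((Bprod μ).natAbs : ℝ) / (Aprod μ : ℝ)| ≤
      (∑ t ∈ Finset.range μ.length, M ^ t) / m := by
  have hm' : (0 : ℝ) < m := by exact_mod_cast hm
  have h := abs_res_sub_le hM₀ hM μ (m : ℤ)
  rw [Int.cast_natCast] at h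
  rw [← abs_ratio, Nat.cast_natAbs, Int.cast_abs, le_div_iff₀ hm', ← abs_of_pos hm',
    ← abs_mul, abs_of_pos hm', sub_mul, div_mul_cancel₀ _ hm'.ne']
  refine le_trans ?_ ((abs_abs_sub_abs_le _ _).trans h)
  rw [abs_mul, abs_of_pos hm', mul_comm]

theorem abs_maxResRatio_sub_le {M : ℝ} (hM₀ : 0 ≤ M)
    (hM : ∀ i j, |(P.B i j : ℝ) / (P.A i j : ℝ)| ≤ M) (n : ℕ) {m : ℕ} (hm : 0 < m) :
    |maxResRatio P n m - maxRatio P n| ≤ (∑ t ∈ Finset.range n, M ^ t) / m := by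
  set ε : ℝ := (∑ t ∈ Finset.range n, M ^ t) / m
  have hε₀ : 0 ≤ ε := by positivity
  have hbdd : BddAbove (insert 0 {x : ℝ | ∃ μ : List (Edge P), IsPath μ ∧ μ.length = n ∧
      x = ((Bprod μ).natAbs : ℝ) / (Aprod μ : ℝ)}) := by
    refine ⟨M ^ n, ?_⟩
    rintro x (rfl | ⟨μ, -, hn, rfl⟩)
    · positivity
    · rw [← abs_ratio, ← hn]
      exact abs_ratio_le hM₀ hM μ
  have hmax₀ : 0 ≤ maxRatio P n := le_csSup hbdd (Set.mem_insert _ _)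
  have hres {x : ℝ} (hx : x ∈ insert 0 {x : ℝ | ∃ μ : List (Edge P), IsPath μ ∧
      μ.length = n ∧ x = ((res (m : ℤ) μ).natAbs : ℝ) / (m : ℝ)}) :
      x ≤ maxRatio P n + ε := by
    rcases hx with rfl | ⟨μ, hμ, hn, rfl⟩
    · positivity
    · have hle : ((Bprod μ).natAbs : ℝ) / (Aprod μ : ℝ) ≤ maxRatio P n :=
        le_csSup hbdd (Set.mem_insert_of_mem _ ⟨μ, hμ, hn, rfl⟩)
      have := (abs_le.1 (abs_natAbs_res_div_sub_le hM₀ hM μ hm)).2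
      rw [hn] at this
      linarith
  have hbdd' : BddAbove (insert 0 {x : ℝ | ∃ μ : List (Edge P), IsPath μ ∧
      μ.length = n ∧ x = ((res (m : ℤ) μ).natAbs : ℝ) / (m : ℝ)}) :=
    ⟨_, fun _ hx => hres hx⟩
  have hmax₀' : 0 ≤ maxResRatio P n m := le_csSup hbdd' (Set.mem_insert _ _)
  have hupper : maxResRatio P n m ≤ maxRatio P n + ε :=
    csSup_le (Set.insert_nonempty _ _) fun _ hx => hres hx
  have hlower : maxRatio P n ≤ maxResRatio P n m + ε := by
    refine csSup_le (Set.insert_nonempty _ _) ?_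
    rintro x (rfl | ⟨μ, hμ, hn, rfl⟩)
    · positivity
    · have hle : ((res (m : ℤ) μ).natAbs : ℝ) / (m : ℝ) ≤ maxResRatio P n m :=
        le_csSup hbdd' (Set.mem_insert_of_mem _ ⟨μ, hμ, hn, rfl⟩)
      have := (abs_le.1 (abs_natAbs_res_div_sub_le hM₀ hM μ hm)).1
      rw [hn] at this
      linarith
  rw [abs_le]
  constructor <;> linarith

theorem tendsto_maxResRatio [Finite V] (P : KatsuraPair V) (n : ℕ) :
    Filter.Tendsto (fun m : ℕ => maxResRatio P n m) Filter.atTop (nhds (maxRatio P n)) := by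
  obtain ⟨M, hM₀, hM⟩ := exists_edge_ratio_le P
  rw [tendsto_iff_norm_sub_tendsto_zero]
  refine squeeze_zero' (Filter.Eventually.of_forall fun _ => norm_nonneg _) ?_
    (tendsto_const_div_atTop_nhds_zero_nat (∑ t ∈ Finset.range n, M ^ t))
  filter_upwards [Filter.eventually_gt_atTop 0] with m hm
  exact abs_maxResRatio_sub_le hM₀ hM n hm

end KatsuraPair

open KatsuraPair Filter in
/-- if `A` has no zero rows, the contraction coefficient of the
action-restriction pair `(ℤ × E_A⁰, E_A)` equals
`limsup_n (max_{μ ∈ E_A^n} |B_μ|/A_μ)^{1/n}`. -/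
theorem statement4 (N : ℕ) (hN : 0 < N) (P : KatsuraPair (Fin N))
    (hrows : ∀ i : Fin N, ∃ j : Fin N, P.A i j ≠ 0) :
    limsup (fun n : ℕ =>
        (limsup (fun m : ℕ => maxResRatio P n m) atTop) ^ ((n : ℝ)⁻¹)) atTop =
    limsup (fun n : ℕ => (maxRatio P n) ^ ((n : ℝ)⁻¹)) atTop := by
  simp_rw [fun n => (tendsto_maxResRatio P n).limsup_eq]
end

section
/- For a Katsura pair (A,B), every m ∈ ℤ and every path μ of length n in E_A with edge labels r_1,…,r_n (i.e. μ_t = e_{i_{t-1},i_t,r_t}), if a^m·μ is the path with edge labels r'_1,…,r'_n, then res(m,μ) = m·(B_μ/A_μ) + Σ_{t=1}^{n} (r_t − r'_t)·(B_{μ[t+1,n]}/A_{μ[t,n]}), where μ[t,n] denotes the subpath μ_t⋯μ_n (and μ[n+1,n] the empty path). -/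
open scoped Classical

namespace KatsuraPair

variable {V : Type} {P : KatsuraPair V}

/-- The label (the `m` of `e_{i,j,m}`) of the `(t+1)`-st edge of `μ` (0-based `t`),
with junk value `0` out of range. -/
def labelAt (μ : List (Edge P)) (t : ℕ) : ℕ := ((μ.drop t).head?).elim 0 (fun e => e.m)

end KatsuraPair

namespace KatsuraPair

variable {V : Type} {P : KatsuraPair V}

@[simp] lemma labelAt_cons_zero (e : Edge P) (ν : List (Edge P)) : labelAt (e :: ν) 0 = e.m := rfl

@[simp] lemma labelAt_cons_succ (e : Edge P) (ν : List (Edge P)) (t : ℕ) :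
    labelAt (e :: ν) (t + 1) = labelAt ν t := rfl

lemma Aprod_cons (e : Edge P) (ν : List (Edge P)) :
    Aprod (e :: ν) = P.A e.i e.j * Aprod ν := by
  simp [Aprod]

lemma Bprod_cons (e : Edge P) (ν : List (Edge P)) :
    Bprod (e :: ν) = P.B e.i e.j * Bprod ν := by
  simp [Bprod]

/-- The division with remainder that defines the action and the restriction on an edge. -/
lemma mul_add_eq_edgeRes_mul_add (k : ℤ) (e : Edge P) :
    k * P.B e.i e.j + (e.m : ℤ) = edgeRes k e * (P.A e.i e.j : ℤ) + ((edgeAct k e).m : ℤ) := by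
  have hA : (P.A e.i e.j : ℤ) ≠ 0 := by exact_mod_cast (Nat.zero_lt_of_lt e.hm).ne'
  have hm : ((edgeAct k e).m : ℤ) = (k * P.B e.i e.j + (e.m : ℤ)) % (P.A e.i e.j : ℤ) :=
    Int.toNat_of_nonneg (Int.emod_nonneg _ hA)
  rw [hm, edgeRes, Int.ediv_mul_add_emod]

/-- The restriction formula, for an arbitrary list of edges. -/
lemma res_eq_mul_div_add_sum (k : ℤ) (μ : List (Edge P)) :
    (res k μ : ℚ) =
      (k : ℚ) * ((Bprod μ : ℚ) / (Aprod μ : ℚ)) +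
      ∑ t ∈ Finset.range μ.length,
        ((labelAt μ t : ℚ) - (labelAt (act k μ) t : ℚ)) *
          ((Bprod (μ.drop (t + 1)) : ℚ) / (Aprod (μ.drop t) : ℚ)) := by
  induction μ generalizing k with
  | nil => simp [res, Aprod, Bprod]
  | cons e ν ih =>
    have hA : (P.A e.i e.j : ℚ) ≠ 0 := by exact_mod_cast (Nat.zero_lt_of_lt e.hm).ne'
    have hdiv : (k : ℚ) * P.B e.i e.j + e.m =
        edgeRes k e * P.A e.i e.j + (edgeAct k e).m := by
      exact_mod_cast mul_add_eq_edgeRes_mul_add k e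
    have hres : (edgeRes k e : ℚ) =
        (k * P.B e.i e.j + (e.m - (edgeAct k e).m)) / P.A e.i e.j := by
      rw [eq_div_iff hA]
      linarith
    simp only [res, act, List.length_cons, Finset.sum_range_succ', labelAt_cons_zero,
      labelAt_cons_succ, List.drop_succ_cons, List.drop_zero]
    rw [ih, hres, Aprod_cons, Bprod_cons]
    push_cast
    simp only [div_eq_mul_inv, mul_inv]
    ring

end KatsuraPair

open KatsuraPair in
/-- the restriction formula
`res(k,μ) = k·B_μ/A_μ + Σ_{t=1}^n (r_t − r'_t)·B_{μ[t+1,n]}/A_{μ[t,n]}`, where `r_t` are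
the labels of `μ` and `r'_t` those of `a^k·μ`. -/
theorem statement5 (N : ℕ) (hN : 0 < N) (P : KatsuraPair (Fin N)) (k : ℤ)
    (μ : List (Edge P)) (hμ : IsPath μ) :
    (res k μ : ℚ) =
      (k : ℚ) * ((Bprod μ : ℚ) / (Aprod μ : ℚ)) +
      ∑ t ∈ Finset.range μ.length,
        ((labelAt μ t : ℚ) - (labelAt (act k μ) t : ℚ)) *
          ((Bprod (μ.drop (t + 1)) : ℚ) / (Aprod (μ.drop t) : ℚ)) := by
  exact res_eq_mul_div_add_sum k μ
end

section
/- Let (A,B) be a Katsura pair such that A has no zero rows. Suppose the action-restriction pair (ℤ × E_A⁰, E_A) is contracting, i.e. there is a finite set F ⊆ ℤ such that for every k ∈ ℤ and every vertex i there is n ∈ ℕ with res(k,μ) ∈ F for all paths μ with r(μ) = i and |μ| ≥ n. Then it is regular: for every k ∈ ℤ and vertex i there is K ∈ ℕ such that if μ is a path with r(μ) = i, |μ| ≥ K and a^k · μ = μ, then res(k,μ) = 0. -/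
open scoped Classical

namespace KatsuraPair

variable {V : Type} {P : KatsuraPair V}

lemma edgeRes_mul_of_edgeAct_eq (r k : ℤ) (e : Edge P) (h : edgeAct k e = e) :
    edgeRes (r * k) e = r * edgeRes k e := by
  have hlt : (e.m : ℤ) < P.A e.i e.j := by exact_mod_cast e.hm
  have hpos : (0 : ℤ) < P.A e.i e.j := by omega
  have hm : (k * P.B e.i e.j + (e.m : ℤ)) % (P.A e.i e.j : ℤ) = e.m := by
    have h1 : ((k * P.B e.i e.j + (e.m : ℤ)) % (P.A e.i e.j : ℤ)).toNat = e.m :=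
      congrArg Edge.m h
    have h2 := Int.emod_nonneg (k * P.B e.i e.j + (e.m : ℤ)) hpos.ne'
    omega
  have hk := Int.emod_add_mul_ediv (k * P.B e.i e.j + (e.m : ℤ)) (P.A e.i e.j : ℤ)
  rw [hm] at hk
  unfold edgeRes
  have hr : r * k * P.B e.i e.j + (e.m : ℤ) = e.m +
      (P.A e.i e.j : ℤ) * (r * ((k * P.B e.i e.j + (e.m : ℤ)) / (P.A e.i e.j : ℤ))) := by
    linear_combination (-r) * hk
  rw [hr, Int.add_mul_ediv_left _ _ hpos.ne', Int.ediv_eq_zero_of_lt (by omega) hlt, zero_add]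

/-- Restriction along a path fixed by `a^k` is homogeneous in `k`. -/
lemma res_mul_of_act_eq (r k : ℤ) (μ : List (Edge P)) (h : act k μ = μ) :
    res (r * k) μ = r * res k μ := by
  induction μ generalizing k with
  | nil => rfl
  | cons e ν ih =>
    simp only [act, List.cons.injEq] at h
    simp only [res]
    rw [edgeRes_mul_of_edgeAct_eq r k e h.1, ih _ h.2]

end KatsuraPair

open KatsuraPair in
/-- if `A` has no zero rows and the action-restriction pair `(ℤ × E_A⁰, E_A)`
is contracting (all restrictions of `a^k` along long enough paths lie in a fixed finite set
`F ⊆ ℤ`), then it is regular: if `a^k` fixes a long enough path `μ`, then `res(k,μ) = 0`. -/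
theorem statement8 (N : ℕ) (hN : 0 < N) (P : KatsuraPair (Fin N))
    (hrows : ∀ i : Fin N, ∃ j : Fin N, P.A i j ≠ 0)
    (hcontr : ∃ F : Finset ℤ, ∀ k : ℤ, ∀ i : Fin N, ∃ n : ℕ,
      ∀ μ : List (Edge P), IsPath μ → rangeIs μ i → n ≤ μ.length → res k μ ∈ F) :
    ∀ k : ℤ, ∀ i : Fin N, ∃ K : ℕ, ∀ μ : List (Edge P),
      IsPath μ → rangeIs μ i → K ≤ μ.length → act k μ = μ → res k μ = 0 := by
  intro k i
  obtain ⟨F, hF⟩ := hcontr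
  obtain ⟨M, hM⟩ := (F.image Int.natAbs).bddAbove
  obtain ⟨n, hn⟩ := hF ((M + 1 : ℕ) * k) i
  refine ⟨n, fun μ hμ hr hlen hact => ?_⟩
  have hmem := hn μ hμ hr hlen
  rw [res_mul_of_act_eq _ _ _ hact] at hmem
  have hle := hM (Finset.mem_coe.2 (Finset.mem_image_of_mem Int.natAbs hmem))
  rw [Int.natAbs_mul, Int.natAbs_natCast] at hle
  by_contra h0
  have : 1 ≤ (res k μ).natAbs := Int.natAbs_pos.2 h0
  nlinarith
end

section
/- Let ξ = (ξ⁰,ξ¹): H → E be an embedding pair and (ℤ×E⁰, E) the associated action-restriction pair. Then: (i) for every (m,v) ∈ ℤ×E⁰ there is n ∈ ℕ such that for every finite path μ in E with r(μ) = v and |μ| ≥ n, the restriction (m,v)|_μ equals (l, s(μ)) for some l ∈ {-1,0,1}; and (ii) for every (m,v) ∈ ℤ×E⁰ there is M ∈ ℕ such that whenever μ is a finite path with r(μ) = v, (m,v)·μ = μ, and (m,v)|_μ does not fix every finite path with range s(μ), then |μ| ≤ M. -/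
open scoped Classical

/-- An embedding pair `ξ = (ξ⁰,ξ¹) : H → E`: two injective homomorphisms of finite directed
graphs that agree on vertices and have disjoint images on edges. -/
structure EmbPair where
  HV : Type
  HE : Type
  EV : Type
  EE : Type
  finHV : Fintype HV
  finHE : Fintype HE
  finEV : Fintype EV
  finEE : Fintype EE
  rH : HE → HV
  sH : HE → HV
  rE : EE → EV
  sE : EE → EV
  ξV : HV → EV
  ξ0 : HE → EE
  ξ1 : HE → EE
  injV : Function.Injective ξV
  inj0 : Function.Injective ξ0
  inj1 : Function.Injective ξ1
  r0 : ∀ h, rE (ξ0 h) = ξV (rH h)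
  s0 : ∀ h, sE (ξ0 h) = ξV (sH h)
  r1 : ∀ h, rE (ξ1 h) = ξV (rH h)
  s1 : ∀ h, sE (ξ1 h) = ξV (sH h)
  disj : ∀ h h', ξ0 h ≠ ξ1 h'

namespace EmbPair

variable (X : EmbPair)

/-- `H¹_ξ = ξ⁰(H¹) ∪ ξ¹(H¹)`. -/
def Hxi : Set X.EE := Set.range X.ξ0 ∪ Set.range X.ξ1

/-- The action of `(m,v)` on an edge `e` with `r(e) = v`: it fixes `e ∉ H¹_ξ`, and maps
`ξ^i(h)` to `ξ^j(h)` where `m + i = 2n + j`, `j ∈ {0,1}`. -/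
noncomputable def edgeAct (m : ℤ) (e : X.EE) : X.EE :=
  if h0 : ∃ h, X.ξ0 h = e then
    (if m % 2 = 0 then X.ξ0 h0.choose else X.ξ1 h0.choose)
  else if h1 : ∃ h, X.ξ1 h = e then
    (if (m + 1) % 2 = 0 then X.ξ0 h1.choose else X.ξ1 h1.choose)
  else e

/-- The restriction of `(m,v)` along an edge `e` with `r(e) = v`: it is `0` when
`e ∉ H¹_ξ`, and `n` with `m + i = 2n + j`, `j ∈ {0,1}`, when `e = ξ^i(h)`. -/
noncomputable def edgeRes (m : ℤ) (e : X.EE) : ℤ :=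
  if _ : ∃ h, X.ξ0 h = e then m / 2
  else if _ : ∃ h, X.ξ1 h = e then (m + 1) / 2
  else 0

/-- Action on finite paths: `(m,v)·(eν) = ((m,v)·e)((m,v)|_e·ν)`. -/
noncomputable def act : ℤ → List X.EE → List X.EE
  | _, [] => []
  | m, e :: ν => X.edgeAct m e :: act (X.edgeRes m e) ν

/-- Restriction along finite paths: `(m,v)|_{eν} = ((m,v)|_e)|_ν`. -/
noncomputable def res : ℤ → List X.EE → ℤ
  | m, [] => m
  | m, e :: ν => res (X.edgeRes m e) ν

/-- A finite path in `E`. -/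
def IsPath (μ : List X.EE) : Prop := μ.Chain' (fun e f => X.sE e = X.rE f)

/-- `r(μ) = v` (vacuously true for the empty path). -/
def rangeIs (μ : List X.EE) (v : X.EV) : Prop := ∀ e ∈ μ.head?, X.rE e = v

/-- The source of a path with range `v`. -/
def src (v : X.EV) (μ : List X.EE) : X.EV := (μ.getLast?).elim v X.sE

/-- A left-infinite path `⋯μ₋₂μ₋₁` in `E`; index `p : ℕ` encodes position `-(p+1)`. -/
def IsLPath (μ : ℕ → X.EE) : Prop := ∀ n, X.sE (μ (n + 1)) = X.rE (μ n)

/-- The finite segment `μ₋ₖ⋯μ₋₁` of a left-infinite path. -/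
def seg (μ : ℕ → X.EE) (k : ℕ) : List X.EE := ((List.range k).reverse).map μ

/-- Asymptotic equivalence of left-infinite paths in `E`. -/
def AsympEquiv (μ ν : ℕ → X.EE) : Prop :=
  ∃ F : Finset ℤ, ∃ g : ℕ → ℤ, ∀ n : ℕ,
    g n ∈ F ∧ X.rE (μ n) = X.rE (ν n) ∧ X.act (g n) (X.seg μ (n + 1)) = X.seg ν (n + 1)

/-- `ξ^b` for a bit `b`. -/
def xiB (b : Bool) : X.HE → X.EE := fun h => bif b then X.ξ1 h else X.ξ0 h

end EmbPair

namespace EmbPair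

variable (X : EmbPair)

theorem natAbs_edgeRes_le (m : ℤ) (e : X.EE) :
    (X.edgeRes m e).natAbs ≤ max (m.natAbs - 1) 1 := by
  unfold edgeRes
  split_ifs <;> omega

theorem natAbs_res_le (m : ℤ) (μ : List X.EE) :
    (X.res m μ).natAbs ≤ max (m.natAbs - μ.length) 1 := by
  induction μ generalizing m with
  | nil => simp [res]
  | cons e ν ih =>
    have h := X.natAbs_edgeRes_le m e
    have h' := ih (X.edgeRes m e)
    simp only [res, List.length_cons]
    omega

theorem edgeAct_zero (e : X.EE) : X.edgeAct 0 e = e := by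
  unfold edgeAct
  split_ifs with h0 _ h1
  · exact h0.choose_spec
  · omega
  · omega
  · exact h1.choose_spec
  · rfl

theorem edgeRes_zero (e : X.EE) : X.edgeRes 0 e = 0 := by
  unfold edgeRes
  split_ifs <;> norm_num

theorem act_zero (μ : List X.EE) : X.act 0 μ = μ := by
  induction μ with
  | nil => rfl
  | cons e ν ih => rw [act, edgeAct_zero, edgeRes_zero, ih]

theorem res_zero (μ : List X.EE) : X.res 0 μ = 0 := by
  induction μ with
  | nil => rfl
  | cons e ν ih => rw [res, edgeRes_zero, ih]

/-- An edge fixed by `m` either kills the restriction or halves it exactly. -/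
theorem edgeRes_of_edgeAct_eq {m : ℤ} {e : X.EE} (h : X.edgeAct m e = e) :
    X.edgeRes m e = 0 ∨ 2 * X.edgeRes m e = m := by
  unfold edgeAct at h
  unfold edgeRes
  split_ifs at h ⊢ with h0 hm h1 hm
  · omega
  · exact absurd (h0.choose_spec.trans h.symm) (X.disj _ _)
  · exact absurd (h.trans h1.choose_spec.symm) (X.disj _ _)
  · omega
  · exact Or.inl rfl

theorem res_of_act_eq {m : ℤ} {μ : List X.EE} (h : X.act m μ = μ) :
    X.res m μ = 0 ∨ 2 ^ μ.length * X.res m μ = m := by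
  induction μ generalizing m with
  | nil => simp [res]
  | cons e ν ih =>
    rw [act, List.cons.injEq] at h
    rw [res]
    rcases X.edgeRes_of_edgeAct_eq h.1 with h0 | h2
    · exact Or.inl (by rw [h0, res_zero])
    · refine (ih h.2).imp_right fun h' => ?_
      rw [List.length_cons, pow_succ', mul_assoc, h', h2]

end EmbPair

open EmbPair in
/-- for an embedding pair, the associated action-restriction pair
`(ℤ×E⁰, E)` is (i) contracting with restrictions eventually in `{-1,0,1}`, and
(ii) regular. -/
theorem statement12 (X : EmbPair) (m : ℤ) (v : X.EV) :
    (∃ n : ℕ, ∀ μ : List X.EE, X.IsPath μ → X.rangeIs μ v → n ≤ μ.length →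
      ∃ l ∈ ({-1, 0, 1} : Set ℤ), X.res m μ = l) ∧
    (∃ M : ℕ, ∀ μ : List X.EE, X.IsPath μ → X.rangeIs μ v → X.act m μ = μ →
      ¬ (∀ ω : List X.EE, X.IsPath ω → X.rangeIs ω (X.src v μ) →
          X.act (X.res m μ) ω = ω) →
      μ.length ≤ M) := by
  refine ⟨⟨m.natAbs, fun μ _ _ hn => ⟨_, ?_, rfl⟩⟩, m.natAbs, fun μ _ _ hfix hne => ?_⟩
  · have h := X.natAbs_res_le m μ
    simp only [Set.mem_insert_iff, Set.mem_singleton_iff]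
    omega
  · have h0 : X.res m μ ≠ 0 := fun h0 => hne fun ω _ _ => by rw [h0, X.act_zero]
    have h2 := (X.res_of_act_eq hfix).resolve_left h0
    calc μ.length ≤ 2 ^ μ.length := Nat.lt_two_pow_self.le
      _ ≤ 2 ^ μ.length * (X.res m μ).natAbs :=
        Nat.le_mul_of_pos_right _ (Int.natAbs_pos.mpr h0)
      _ = (2 ^ μ.length * X.res m μ).natAbs := by simp [Int.natAbs_mul, Int.natAbs_pow]
      _ = m.natAbs := by rw [h2]
end
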